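/- There exists a constant A > 0 such that for every integer r ≥ 3 there are positive integers n₀ = n₀(r) and L₀ = L₀(r) with the following property: for every n ≥ n₀ and L ≥ L₀, if G is a linear r-uniform hypergraph on n vertices whose chromatic index satisfies χ'(G) ≤ L, then θ̃(G) ≤ A · (r+1) · L^{2 + 1/(r−1)} · log n. -/

import Mathlib

/-- A hypergraph is linear if any two distinct edges intersect in at most one vertex. -/
def IsLinear {V : Type*} [DecidableEq V] (G : Finset (Finset V)) : Prop :=
  ∀ e ∈ G, ∀ f ∈ G, e ≠ f → (e ∩ f).card ≤ 1

/-- A set of cardinality `t` (modeled as `Fin t`) `k`-represents an `r`-uniform hypergraph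
with edge set `G`. -/
def KRepresents {V : Type*} [DecidableEq V] (r k t : ℕ) (G : Finset (Finset V)) : Prop :=
  ∃ S : V → Finset (Fin t),
    ∀ e : Finset V, e.card = r → (e ∈ G ↔ k ≤ (e.inf S).card)

/-- `θ̃(G) = min_{k ≥ 1} θ_k(G)`. -/
noncomputable def thetaTilde {V : Type*} [DecidableEq V] (r : ℕ) (G : Finset (Finset V)) : ℕ :=
  sInf {t | ∃ k : ℕ, 1 ≤ k ∧ KRepresents r k t G}

/-- The chromatic index `χ'(G)`: the smallest `L` such that `E(G)` can be partitioned
into `L` matchings. -/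
noncomputable def chromIndex {V : Type*} [DecidableEq V] (G : Finset (Finset V)) : ℕ :=
  sInf {L : ℕ | ∃ c : Finset V → ℕ, (∀ e ∈ G, c e < L) ∧
    ∀ e ∈ G, ∀ f ∈ G, e ≠ f → c e = c f → Disjoint e f}


open Finset in
/-- If each of the finitely many functions `Y i` is bounded by `1` and has mean at most `-δ`, and
there are fewer than `exp (t δ² / 4)` of them, then some sample of size `t` makes all the sums
negative. -/
theorem exists_sample_sum_neg {Ω ι : Type*} [Fintype Ω] [Nonempty Ω] (I : Finset ι)
    (Y : ι → Ω → ℝ) (δ : ℝ) (t : ℕ) (hδ : 0 < δ) (hδ1 : δ ≤ 1)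
    (hY : ∀ i ∈ I, ∀ ω, |Y i ω| ≤ 1)
    (hmean : ∀ i ∈ I, ∑ ω, Y i ω ≤ -δ * Fintype.card Ω)
    (hI : (I.card : ℝ) * Real.exp (-(t * (δ ^ 2 / 4))) < 1) :
    ∃ f : Fin t → Ω, ∀ i ∈ I, ∑ j, Y i (f j) < 0 := by
  classical
  by_contra! hcon
  have hcard : (0 : ℝ) < Fintype.card Ω := by exact_mod_cast Fintype.card_pos
  have hmgf : ∀ i ∈ I, ∑ ω, Real.exp (δ / 2 * Y i ω) ≤
      Fintype.card Ω * Real.exp (-(δ ^ 2 / 4)) := by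
    intro i hi
    have hpt : ∀ ω, Real.exp (δ / 2 * Y i ω) ≤ 1 + δ ^ 2 / 4 + δ / 2 * Y i ω := by
      intro ω
      have hy := hY i hi ω
      have hsq : Y i ω ^ 2 ≤ 1 := by rwa [sq_le_one_iff_abs_le_one]
      have hx : |δ / 2 * Y i ω| ≤ 1 := by
        rw [abs_mul, abs_of_pos (by positivity)]
        nlinarith [abs_nonneg (Y i ω)]
      have := (abs_le.1 (Real.abs_exp_sub_one_sub_id_le hx)).2
      nlinarith [sq_nonneg δ]
    calc ∑ ω, Real.exp (δ / 2 * Y i ω)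
        ≤ ∑ ω, (1 + δ ^ 2 / 4 + δ / 2 * Y i ω) := sum_le_sum fun ω _ => hpt ω
      _ = Fintype.card Ω * (1 + δ ^ 2 / 4) + δ / 2 * ∑ ω, Y i ω := by
          rw [sum_add_distrib, ← mul_sum, sum_const, card_univ, nsmul_eq_mul]
      _ ≤ Fintype.card Ω * (-(δ ^ 2 / 4) + 1) := by
          nlinarith [mul_le_mul_of_nonneg_left (hmean i hi) hδ.le]
      _ ≤ _ := by gcongr; exact Real.add_one_le_exp _
  have hprod : ∀ i ∈ I, ∑ f : Fin t → Ω, Real.exp (δ / 2 * ∑ j, Y i (f j)) ≤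
      (Fintype.card Ω : ℝ) ^ t * Real.exp (-(t * (δ ^ 2 / 4))) := by
    intro i hi
    calc ∑ f : Fin t → Ω, Real.exp (δ / 2 * ∑ j, Y i (f j))
        = ∑ f : Fin t → Ω, ∏ j, Real.exp (δ / 2 * Y i (f j)) := by
          simp_rw [mul_sum, Real.exp_sum]
      _ = (∑ ω, Real.exp (δ / 2 * Y i ω)) ^ t := by
          rw [Fintype.sum_pow]
      _ ≤ (Fintype.card Ω * Real.exp (-(δ ^ 2 / 4))) ^ t := by
          gcongr; exact hmgf i hi
      _ = _ := by
          rw [mul_pow, ← Real.exp_nat_mul]; ring_nf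
  have hlow : (Fintype.card Ω : ℝ) ^ t ≤
      ∑ f : Fin t → Ω, ∑ i ∈ I, Real.exp (δ / 2 * ∑ j, Y i (f j)) := by
    calc (Fintype.card Ω : ℝ) ^ t = ∑ _f : Fin t → Ω, (1 : ℝ) := by simp
      _ ≤ _ := by
        refine sum_le_sum fun f _ => ?_
        obtain ⟨i, hi, hf⟩ := hcon f
        refine le_trans (Real.one_le_exp (by positivity)) (single_le_sum
          (f := fun i => Real.exp (δ / 2 * ∑ j, Y i (f j))) (fun _ _ => by positivity) hi)
  rw [sum_comm] at hlow
  have hup := sum_le_sum hprod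
  rw [sum_const, nsmul_eq_mul] at hup
  have : (0 : ℝ) < (Fintype.card Ω : ℝ) ^ t := by positivity
  nlinarith

open Finset in
/-- The number of `m`-ary words vanishing on a given set of positions. -/
theorem card_filter_forall_mem_eq_zero {B : Type*} [Fintype B] [DecidableEq B] (m : ℕ) [NeZero m]
    (A : Finset B) :
    (#{x : B → Fin m | ∀ b ∈ A, x b = 0} : ℝ) =
      Fintype.card (B → Fin m) * (1 / (m : ℝ)) ^ A.card := by
  have hm : (m : ℝ) ≠ 0 := by exact_mod_cast NeZero.ne m
  have h : ({x : B → Fin m | ∀ b ∈ A, x b = 0} : Finset _) =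
      Fintype.piFinset fun b => if b ∈ A then {0} else univ := by
    ext x
    simp only [mem_filter, mem_univ, true_and, Fintype.mem_piFinset]
    refine forall_congr' fun b => ?_
    split_ifs with hb <;> simp [hb]
  have h2 : ∏ b : B, #(if b ∈ A then ({0} : Finset (Fin m)) else univ) =
      m ^ (Fintype.card B - A.card) := by
    rw [← card_compl, ← prod_const, ← prod_subset (subset_univ Aᶜ)]
    · exact prod_congr rfl fun b hb => by simp [mem_compl.1 hb]
    · intro b _ hb
      simp [not_not.1 (mt mem_compl.2 hb)]
  rw [h, Fintype.card_piFinset, h2]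
  have := card_le_univ A
  simp only [Fintype.card_fun, Fintype.card_fin, Nat.cast_pow]
  rw [one_div, inv_pow, eq_mul_inv_iff_mul_eq₀ (by positivity), ← pow_add]
  congr 1; omega

section ColorBlock

variable {V : Type*} [DecidableEq V]

open Classical in
/-- The edge of colour `i` containing `v`, or `{v}` if there is none. -/
noncomputable def colorBlock (G : Finset (Finset V)) (c : Finset V → ℕ) (i : ℕ) (v : V) :
    Finset V :=
  if h : ∃ f ∈ G, c f = i ∧ v ∈ f then h.choose else {v}

variable {G : Finset (Finset V)} {c : Finset V → ℕ} {i r : ℕ}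

theorem colorBlock_mem_or_eq_singleton (v : V) :
    (colorBlock G c i v ∈ G ∧ c (colorBlock G c i v) = i ∧ v ∈ colorBlock G c i v) ∨
      colorBlock G c i v = {v} := by
  classical
  unfold colorBlock
  split_ifs with h
  · exact Or.inl h.choose_spec
  · exact Or.inr rfl

theorem mem_colorBlock (v : V) : v ∈ colorBlock G c i v := by
  rcases colorBlock_mem_or_eq_singleton (G := G) (c := c) (i := i) v with h | h
  · exact h.2.2
  · simp [h]

theorem colorBlock_eq_of_mem
    (hc : ∀ e ∈ G, ∀ f ∈ G, e ≠ f → c e = c f → Disjoint e f)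
    {f : Finset V} (hf : f ∈ G) {v : V} (hv : v ∈ f) : colorBlock G c (c f) v = f := by
  have h : ∃ g ∈ G, c g = c f ∧ v ∈ g := ⟨f, hf, rfl, hv⟩
  have hb : colorBlock G c (c f) v = h.choose := by unfold colorBlock; exact dif_pos h
  obtain ⟨h1, h2, h3⟩ := h.choose_spec
  rw [hb]
  by_contra hne
  exact Finset.disjoint_left.1 (hc _ h1 _ hf hne h2) h3 hv

theorem colorBlock_mem_of_eq {u v : V} (huv : u ≠ v)
    (h : colorBlock G c i u = colorBlock G c i v) :
    colorBlock G c i u ∈ G ∧ c (colorBlock G c i u) = i ∧ v ∈ colorBlock G c i u := by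
  have hv : v ∈ colorBlock G c i u := h ▸ mem_colorBlock v
  rcases colorBlock_mem_or_eq_singleton (G := G) (c := c) (i := i) u with h' | h'
  · exact ⟨h'.1, h'.2.1, hv⟩
  · rw [h', Finset.mem_singleton] at hv
    exact absurd hv.symm huv

theorem card_image_colorBlock_of_mem
    (hc : ∀ e ∈ G, ∀ f ∈ G, e ≠ f → c e = c f → Disjoint e f)
    {e : Finset V} (he : e ∈ G) : (e.image (colorBlock G c (c e))).card ≤ 1 := by
  refine (Finset.card_le_card (t := {e}) fun b hb => ?_).trans (by simp)
  obtain ⟨v, hv, rfl⟩ := Finset.mem_image.1 hb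
  exact Finset.mem_singleton.2 (colorBlock_eq_of_mem hc he hv)

theorem two_le_card_image_colorBlock (hG : ∀ e ∈ G, e.card = r) (hr : 2 ≤ r)
    {e : Finset V} (her : e.card = r) (he : e ∉ G) :
    2 ≤ (e.image (colorBlock G c i)).card := by
  by_contra! hlt
  obtain ⟨u, hu, v, hv, huv⟩ := Finset.one_lt_card.1 (by omega : 1 < e.card)
  have hall : ∀ w ∈ e, colorBlock G c i u = colorBlock G c i w := fun w hw =>
    Finset.card_le_one.1 (by omega) _ (Finset.mem_image_of_mem _ hu) _
      (Finset.mem_image_of_mem _ hw)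
  have hmem := (colorBlock_mem_of_eq huv (hall v hv)).1
  have hsub : e ⊆ colorBlock G c i u := fun w hw => hall w hw ▸ mem_colorBlock w
  rw [← Finset.eq_of_subset_of_card_le hsub (by rw [hG _ hmem, her])] at hmem
  exact he hmem

/-- In a linear hypergraph few colours identify two vertices of a given set. -/
theorem card_filter_card_image_colorBlock_lt (hlin : IsLinear G) (e : Finset V) (L : ℕ) :
    (Finset.univ.filter fun i : Fin L => (e.image (colorBlock G c i)).card < e.card).card ≤
      e.card ^ 2 := by
  classical
  rcases e.eq_empty_or_nonempty with rfl | ⟨v₀, -⟩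
  · simp
  have : Nonempty (V × V) := ⟨(v₀, v₀)⟩
  have hex : ∀ i : Fin L, (e.image (colorBlock G c i)).card < e.card →
      ∃ q : V × V, q.1 ∈ e ∧ q.2 ∈ e ∧ q.1 ≠ q.2 ∧
        colorBlock G c i q.1 = colorBlock G c i q.2 := by
    intro i hi
    obtain ⟨u, hu, v, hv, huv, h⟩ := Finset.exists_ne_map_eq_of_card_lt_of_maps_to hi
      fun w hw => Finset.mem_image_of_mem _ hw
    exact ⟨(u, v), hu, hv, huv, h⟩
  choose! q hq1 hq2 hq3 hq4 using hex
  rw [sq, ← Finset.card_product]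
  refine Finset.card_le_card_of_injOn q ?_ ?_
  · intro i hi
    have hi := (Finset.mem_filter.1 hi).2
    exact Finset.mem_product.2 ⟨hq1 i hi, hq2 i hi⟩
  · intro i hi j hj hij
    have hi := (Finset.mem_filter.1 hi).2
    have hj := (Finset.mem_filter.1 hj).2
    obtain ⟨hi1, hi2, hi3⟩ := colorBlock_mem_of_eq (hq3 i hi) (hq4 i hi)
    obtain ⟨hj1, hj2, hj3⟩ := colorBlock_mem_of_eq (hq3 j hj) (hq4 j hj)
    have hui := mem_colorBlock (G := G) (c := c) (i := i) (q i).1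
    have huj := mem_colorBlock (G := G) (c := c) (i := j) (q j).1
    rw [← hij] at huj hj3
    by_contra hne
    have hne' : colorBlock G c i (q i).1 ≠ colorBlock G c j (q j).1 := fun h =>
      hne (Fin.ext (hi2.symm.trans ((congrArg c h).trans hj2)))
    have hle := hlin _ hi1 _ hj1 hne'
    rw [← hij] at hle
    exact hq3 i hi (Finset.card_le_one.1 hle _ (Finset.mem_inter.2 ⟨hui, huj⟩) _
      (Finset.mem_inter.2 ⟨hi3, hj3⟩))

end ColorBlock

section RandomRepresentation

variable {n r L : ℕ} {G : Finset (Finset (Fin n))} {c : Finset (Fin n) → ℕ}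

open Finset in
theorem card_filter_forall_colorBlock_eq_zero (m : ℕ) [NeZero m] (e : Finset (Fin n)) :
    (#{ω : Fin L × (Finset (Fin n) → Fin m) | ∀ v ∈ e, ω.2 (colorBlock G c ω.1 v) = 0} : ℝ) =
      Fintype.card (Finset (Fin n) → Fin m) *
        ∑ i : Fin L, (1 / (m : ℝ)) ^ (e.image (colorBlock G c i)).card := by
  rw [mul_sum]
  simp_rw [← card_filter_forall_mem_eq_zero m]
  simp_rw [card_filter]
  push_cast
  rw [Fintype.sum_prod_type]
  simp

open Finset in
theorem le_sum_pow_card_image_colorBlock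
    (hc : ∀ e ∈ G, ∀ f ∈ G, e ≠ f → c e = c f → Disjoint e f) {e : Finset (Fin n)} (he : e ∈ G)
    (her : e.card = r) (hcL : c e < L) {p : ℝ} (hp : 0 ≤ p) (hp1 : p ≤ 1) :
    L * p ^ r + (p - p ^ r) ≤ ∑ i : Fin L, p ^ (e.image (colorBlock G c i)).card := by
  calc L * p ^ r + (p - p ^ r)
      = ∑ i : Fin L, (p ^ r + if i = ⟨c e, hcL⟩ then p - p ^ r else 0) := by
        rw [sum_add_distrib]; simp
    _ ≤ _ := by
        refine sum_le_sum fun i _ => ?_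
        split_ifs with hi
        · subst hi
          rw [add_sub_cancel]
          exact (pow_one p).symm.le.trans
            (pow_le_pow_of_le_one hp hp1 (card_image_colorBlock_of_mem hc he))
        · rw [add_zero]
          exact pow_le_pow_of_le_one hp hp1 (card_image_le.trans her.le)

open Finset in
theorem sum_pow_card_image_colorBlock_le (hG : ∀ e ∈ G, e.card = r) (hr : 2 ≤ r)
    (hlin : IsLinear G) {e : Finset (Fin n)} (he : e ∉ G) (her : e.card = r)
    {p : ℝ} (hp : 0 ≤ p) (hp1 : p ≤ 1) :
    ∑ i : Fin L, p ^ (e.image (colorBlock G c i)).card ≤ L * p ^ r + r ^ 2 * p ^ 2 := by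
  calc ∑ i : Fin L, p ^ (e.image (colorBlock G c i)).card
      ≤ ∑ i : Fin L,
          (p ^ r + if (e.image (colorBlock G c i)).card < e.card then p ^ 2 else 0) := by
        refine sum_le_sum fun i _ => ?_
        split_ifs with hi
        · exact (pow_le_pow_of_le_one hp hp1 (two_le_card_image_colorBlock hG hr her he)).trans
            (le_add_of_nonneg_left (by positivity))
        · rw [add_zero]
          exact pow_le_pow_of_le_one hp hp1 (her.symm.le.trans (not_lt.1 hi))
    _ = L * p ^ r +
          #{i : Fin L | (e.image (colorBlock G c i)).card < e.card} * p ^ 2 := by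
        rw [sum_add_distrib, ← sum_filter, sum_const, sum_const]; simp
    _ ≤ _ := by
        have h := card_filter_card_image_colorBlock_lt (c := c) hlin e L
        rw [her] at h ⊢
        gcongr
        exact_mod_cast h

open Finset in
theorem exists_kRepresents (hr : 2 ≤ r) (hG : ∀ e ∈ G, e.card = r) (hlin : IsLinear G)
    (hcL : ∀ e ∈ G, c e < L) (hc : ∀ e ∈ G, ∀ f ∈ G, e ≠ f → c e = c f → Disjoint e f)
    (hL : 0 < L) {t : ℕ} (ht : 0 < t)
    (hnt : (n : ℝ) ^ r * Real.exp (-(t * ((1 / (16 * r ^ 2 * L)) ^ 2 / 4) : ℝ)) < 1) :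
    ∃ k : ℕ, 1 ≤ k ∧ KRepresents r k t G := by
  classical
  have hm : NeZero (4 * r ^ 2) := ⟨by positivity⟩
  have : NeZero L := ⟨hL.ne'⟩
  have hL1 : (1 : ℝ) ≤ L := by exact_mod_cast hL
  have hr2 : (2 : ℝ) ≤ r := by exact_mod_cast hr
  obtain ⟨p, hpdef⟩ : ∃ p : ℝ, p = 1 / ((4 * r ^ 2 : ℕ) : ℝ) := ⟨_, rfl⟩
  have hp : 0 < p := by rw [hpdef]; positivity
  have hrp : (r : ℝ) ^ 2 * p = 1 / 4 := by
    rw [hpdef]; push_cast; field_simp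
  have hp4 : p ≤ 1 / 4 := by nlinarith
  have hpr : p ^ r ≤ p / 4 := by
    have := pow_le_pow_of_le_one hp.le (by linarith) hr
    nlinarith
  have hpr0 : 0 < p ^ r := by positivity
  obtain ⟨τ, hτdef⟩ : ∃ τ : ℝ, τ = p ^ r + p / (2 * L) := ⟨_, rfl⟩
  have hLτ : L * τ = L * p ^ r + p / 2 := by rw [hτdef]; field_simp
  have hτ : 0 < τ := by rw [hτdef]; positivity
  have hτ1 : τ ≤ 1 := by nlinarith
  obtain ⟨δ, hδdef⟩ : ∃ δ : ℝ, δ = 1 / (16 * r ^ 2 * L) := ⟨_, rfl⟩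
  have hLδ : L * δ = p / 4 := by rw [hδdef, hpdef]; push_cast; field_simp; norm_num
  have hδ : 0 < δ := by rw [hδdef]; positivity
  have hδ1 : δ ≤ 1 := by nlinarith
  let Ω := Fin L × (Finset (Fin n) → Fin (4 * r ^ 2))
  let W : Finset (Fin n) → Ω → ℝ := fun e ω =>
    if ∀ v ∈ e, ω.2 (colorBlock G c ω.1 v) = 0 then 1 else 0
  obtain ⟨M, hM⟩ : ∃ M : ℝ, M = Fintype.card (Finset (Fin n) → Fin (4 * r ^ 2)) := ⟨_, rfl⟩
  have hM0 : 0 ≤ M := hM ▸ Nat.cast_nonneg _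
  have hΩ : (Fintype.card Ω : ℝ) = L * M := by
    rw [hM, Fintype.card_prod, Fintype.card_fin]; push_cast; rfl
  have hW : ∀ e, ∑ ω, W e ω =
      M * ∑ i : Fin L, p ^ (e.image (colorBlock G c i)).card := by
    intro e
    rw [hpdef, hM, ← card_filter_forall_colorBlock_eq_zero (G := G) (c := c) (L := L), card_filter]
    push_cast
    rfl
  have hW01 : ∀ e ω, 0 ≤ W e ω ∧ W e ω ≤ 1 := by
    intro e ω
    simp only [W]
    split_ifs <;> norm_num
  obtain ⟨f, hf⟩ := exists_sample_sum_neg (Ω := Ω) (powersetCard r univ)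
    (fun e ω => if e ∈ G then τ - W e ω else W e ω - τ) δ t hδ hδ1
    (by
      intro e _ ω
      obtain ⟨h0, h1⟩ := hW01 e ω
      split_ifs <;> rw [abs_le] <;> constructor <;> linarith)
    (by
      intro e he
      have her := (mem_powersetCard.1 he).2
      rw [hΩ]
      split_ifs with heG
      · have h := mul_le_mul_of_nonneg_left (le_sum_pow_card_image_colorBlock hc heG her
          (hcL e heG) hp.le (by linarith)) hM0
        rw [← hW] at h
        rw [sum_sub_distrib, sum_const, card_univ, nsmul_eq_mul, hΩ]
        have h3 : L * M * τ = M * (L * p ^ r + p / 2) := by rw [← hLτ]; ring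
        have h4 : -δ * (L * M) = -(M * (p / 4)) := by rw [← hLδ]; ring
        rw [h3, h4]
        nlinarith [mul_le_mul_of_nonneg_left hpr hM0]
      · have h := mul_le_mul_of_nonneg_left (sum_pow_card_image_colorBlock_le (c := c) (L := L)
          hG hr hlin heG her hp.le (by linarith)) hM0
        rw [← hW] at h
        rw [sum_sub_distrib, sum_const, card_univ, nsmul_eq_mul, hΩ]
        have h3 : L * M * τ = M * (L * p ^ r + p / 2) := by rw [← hLτ]; ring
        have h4 : -δ * (L * M) = -(M * (p / 4)) := by rw [← hLδ]; ring
        have h5 : (r : ℝ) ^ 2 * p ^ 2 = p / 4 := by rw [sq p, ← mul_assoc, hrp]; ring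
        rw [h5] at h
        rw [h3, h4]
        linarith)
    (by
      refine lt_of_le_of_lt ?_ hnt
      rw [hδdef]
      gcongr
      rw [card_powersetCard, card_univ, Fintype.card_fin]
      exact_mod_cast Nat.choose_le_pow n r)
  refine ⟨⌈t * τ⌉₊, Nat.one_le_iff_ne_zero.2 (Nat.ceil_pos.2 (by positivity)).ne',
    fun v => univ.filter fun j => (f j).2 (colorBlock G c (f j).1 v) = 0, fun e her => ?_⟩
  have hinf : e.inf (fun v => univ.filter fun j => (f j).2 (colorBlock G c (f j).1 v) = 0) =
      univ.filter fun j => ∀ v ∈ e, (f j).2 (colorBlock G c (f j).1 v) = 0 := by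
    ext j
    rw [← singleton_subset_iff, Finset.le_inf_iff]
    simp
  have hcard : ((e.inf fun v => univ.filter fun j =>
      (f j).2 (colorBlock G c (f j).1 v) = 0).card : ℝ) = ∑ j, W e (f j) := by
    rw [hinf, card_filter]
    push_cast
    rfl
  have h := hf e (mem_powersetCard.2 ⟨subset_univ e, her⟩)
  rw [Nat.ceil_le, hcard]
  split_ifs at h with heG
  · rw [sum_sub_distrib, sum_const, card_univ, Fintype.card_fin, nsmul_eq_mul] at h
    exact ⟨fun _ => by linarith, fun _ => heG⟩
  · rw [sum_sub_distrib, sum_const, card_univ, Fintype.card_fin, nsmul_eq_mul] at h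
    exact ⟨fun h' => absurd h' heG, fun _ => by linarith⟩

end RandomRepresentation

/-- A colouring of the edges by `chromIndex G` matchings. -/
theorem exists_coloring_chromIndex {V : Type*} [DecidableEq V] (G : Finset (Finset V)) :
    ∃ c : Finset V → ℕ, (∀ e ∈ G, c e < chromIndex G) ∧
      ∀ e ∈ G, ∀ f ∈ G, e ≠ f → c e = c f → Disjoint e f := by
  classical
  refine Nat.sInf_mem (s := {L : ℕ | ∃ c : Finset V → ℕ, (∀ e ∈ G, c e < L) ∧
    ∀ e ∈ G, ∀ f ∈ G, e ≠ f → c e = c f → Disjoint e f})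
    ⟨G.card, fun e => if h : e ∈ G then G.equivFin ⟨e, h⟩ else 0, fun e he => ?_,
      fun e he f hf hne h => ?_⟩
  · simp [he]
  · simp only [he, hf, dif_pos, Fin.val_inj, EmbeddingLike.apply_eq_iff_eq, Subtype.mk.injEq] at h
    exact absurd h hne

/-- **Main lemma (linear case).** There is a constant `A > 0` such that for every `r ≥ 3`
there are positive integers `n₀(r)`, `L₀(r)` such that for all `n ≥ n₀` and `L ≥ L₀`,
every linear `r`-uniform hypergraph `G` on `n` vertices with `χ'(G) ≤ L` satisfies
`θ̃(G) ≤ A · (r+1) · L^{2 + 1/(r−1)} · log n`. -/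
theorem thetaTilde_le_of_chromIndex_le_linear :
    ∃ A : ℝ, 0 < A ∧
      ∀ r : ℕ, 3 ≤ r →
        ∃ n₀ L₀ : ℕ, 0 < n₀ ∧ 0 < L₀ ∧
          ∀ (n L : ℕ) (G : Finset (Finset (Fin n))),
            n₀ ≤ n → L₀ ≤ L →
            (∀ e ∈ G, e.card = r) →
            IsLinear G →
            chromIndex G ≤ L →
            (thetaTilde r G : ℝ) ≤
              A * ((r : ℝ) + 1) * (L : ℝ) ^ ((2 : ℝ) + 1 / ((r : ℝ) - 1)) * Real.log n := by
  refine ⟨1, one_pos, fun r hr => ⟨3, (1025 * r ^ 5) ^ (r - 1), by norm_num, by positivity, ?_⟩⟩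
  intro n L G hn hL hG hlin hχ
  obtain ⟨c, hcL, hc⟩ := exists_coloring_chromIndex G
  have hL0 : 0 < L := lt_of_lt_of_le (by positivity) hL
  have hr3 : (3 : ℝ) ≤ r := by exact_mod_cast hr
  have hn0 : (0 : ℝ) < n := by exact_mod_cast (by omega : 0 < n)
  have hLR : (1 : ℝ) ≤ L := by exact_mod_cast hL0
  have hlog : 1 ≤ Real.log n := by
    rw [Real.le_log_iff_exp_le hn0]
    exact Real.exp_one_lt_three.le.trans (by exact_mod_cast hn)
  obtain ⟨x, hx⟩ : ∃ x : ℝ, x = 1024 * r ^ 5 * L ^ 2 * Real.log n := ⟨_, rfl⟩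
  have hx0 : 0 ≤ x := by rw [hx]; positivity
  have ht := Nat.lt_floor_add_one x
  obtain ⟨k, hk, hrep⟩ := exists_kRepresents (t := ⌊x⌋₊ + 1) (by omega) hG hlin
    (fun e he => (hcL e he).trans_le hχ) hc hL0 (Nat.succ_pos _) (by
      rw [← Real.exp_log (pow_pos hn0 r), ← Real.exp_add, Real.exp_lt_one_iff, Real.log_pow]
      have h : r * Real.log n = x * ((1 / (16 * r ^ 2 * L)) ^ 2 / 4) := by
        rw [hx]; field_simp; norm_num
      have h' := mul_lt_mul_of_pos_right ht
        (show (0 : ℝ) < (1 / (16 * r ^ 2 * L)) ^ 2 / 4 by positivity)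
      push_cast
      linarith)
  have hθ : thetaTilde r G ≤ ⌊x⌋₊ + 1 := Nat.sInf_le ⟨k, hk, hrep⟩
  have hθ' : (thetaTilde r G : ℝ) ≤ ⌊x⌋₊ + 1 := by exact_mod_cast hθ
  have hroot : 1025 * (r : ℝ) ^ 5 ≤ (L : ℝ) ^ (1 / ((r : ℝ) - 1)) := by
    have hcast : ((r - 1 : ℕ) : ℝ) = (r : ℝ) - 1 := by
      rw [Nat.cast_sub (by omega), Nat.cast_one]
    have hLp : (1025 * (r : ℝ) ^ 5) ^ (r - 1) ≤ L := by exact_mod_cast hL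
    calc 1025 * (r : ℝ) ^ 5
        = ((1025 * (r : ℝ) ^ 5) ^ (r - 1)) ^ (1 / ((r : ℝ) - 1)) := by
          rw [one_div, ← hcast, Real.pow_rpow_inv_natCast (by positivity) (by omega)]
      _ ≤ _ := Real.rpow_le_rpow (by positivity) hLp
          (one_div_nonneg.2 (by linarith))
  have hone : 1 ≤ (r : ℝ) ^ 5 * L ^ 2 * Real.log n :=
    one_le_mul_of_one_le_of_one_le (one_le_mul_of_one_le_of_one_le
      (one_le_pow₀ (by linarith)) (one_le_pow₀ hLR)) hlog
  calc (thetaTilde r G : ℝ) ≤ x + 1 := hθ'.trans (by linarith [Nat.floor_le hx0])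
    _ ≤ 1 * (1025 * (r : ℝ) ^ 5) * L ^ 2 * Real.log n := by rw [hx]; linarith
    _ ≤ (r + 1) * (L : ℝ) ^ (1 / ((r : ℝ) - 1)) * L ^ 2 * Real.log n := by
        gcongr
        linarith
    _ = _ := by
        rw [Real.rpow_add (by linarith), Real.rpow_two]; ring
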